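/- Let L be a finite semidistrim lattice. The maps x ↦ D_L(x) and x ↦ U_L(x) are each bijections from L onto the collection Ind(G_L) of independent sets of the Galois graph G_L. -/

import Mathlib

universe u

/-- An element of a lattice is join-irreducible if it covers exactly one element. -/
def JoinIrred {α : Type u} [Lattice α] (j : α) : Prop := ∃! y : α, y ⋖ j

/-- An element of a lattice is meet-irreducible if it is covered by exactly one element. -/
def MeetIrred {α : Type u} [Lattice α] (m : α) : Prop := ∃! y : α, m ⋖ y

/-- `j` is join-prime if `j ≤ x ⊔ y` implies `j ≤ x` or `j ≤ y`. -/
def JoinPrime {α : Type u} [Lattice α] (j : α) : Prop :=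
  ∀ x y : α, j ≤ x ⊔ y → j ≤ x ∨ j ≤ y

/-- `m` is meet-prime if `x ⊓ y ≤ m` implies `x ≤ m` or `y ≤ m`. -/
def MeetPrime {α : Type u} [Lattice α] (m : α) : Prop :=
  ∀ x y : α, x ⊓ y ≤ m → x ≤ m ∨ y ≤ m

/-- `(j0, m0)` is a prime pair: the lattice is the disjoint union of `[⊥, m0]` and `[j0, ⊤]`,
i.e. every element satisfies exactly one of `z ≤ m0` or `j0 ≤ z`. -/
def IsPrimePair {α : Type u} [Lattice α] (j0 m0 : α) : Prop :=
  ∀ z : α, (z ≤ m0 ∨ j0 ≤ z) ∧ ¬(z ≤ m0 ∧ j0 ≤ z)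

/-- A pairing is a bijection `κ` from join-irreducibles to meet-irreducibles such that
`κ j` is maximal in `{z | j ⊓ z = j_*}` and `j = κ⁻¹ (κ j)` is minimal in
`{z | κ j ⊔ z = (κ j)^*}`. -/
def IsPairing {α : Type u} [Lattice α]
    (κ : {j : α // JoinIrred j} → {m : α // MeetIrred m}) : Prop :=
  Function.Bijective κ ∧
    (∀ (j : {j : α // JoinIrred j}) (jst : α), jst ⋖ j.1 →
      Maximal (fun z : α => j.1 ⊓ z = jst) (κ j).1) ∧
    (∀ (j : {j : α // JoinIrred j}) (mst : α), (κ j).1 ⋖ mst →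
      Minimal (fun z : α => (κ j).1 ⊔ z = mst) j.1)

/-- The edge relation of the Galois graph: `j → j'` iff `j ≠ j'` and `j ≰ κ j'`. -/
def GaloisEdge {α : Type u} [Lattice α]
    (κ : {j : α // JoinIrred j} → {m : α // MeetIrred m})
    (j j' : {j : α // JoinIrred j}) : Prop :=
  j ≠ j' ∧ ¬ j.1 ≤ (κ j').1

/-- Independent sets of the Galois graph (no edge in either direction). -/
def IndepSet {α : Type u} [Lattice α]
    (κ : {j : α // JoinIrred j} → {m : α // MeetIrred m})
    (S : Set {j : α // JoinIrred j}) : Prop :=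
  ∀ j ∈ S, ∀ j' ∈ S, ¬ GaloisEdge κ j j'

/-- The downward label set `D_L(x)`: labels of the cover relations `y ⋖ x`. -/
def DLabel {α : Type u} [Lattice α]
    (κ : {j : α // JoinIrred j} → {m : α // MeetIrred m}) (x : α) :
    Set {j : α // JoinIrred j} :=
  {j | ∃ y : α, y ⋖ x ∧ j.1 ≤ x ∧ y ≤ (κ j).1}

/-- The upward label set `U_L(x)`: labels of the cover relations `x ⋖ y`. -/
def ULabel {α : Type u} [Lattice α]
    (κ : {j : α // JoinIrred j} → {m : α // MeetIrred m}) (x : α) :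
    Set {j : α // JoinIrred j} :=
  {j | ∃ y : α, x ⋖ y ∧ j.1 ≤ y ∧ x ≤ (κ j).1}

/-- A uniquely paired lattice is overlapping if every cover relation has a unique label. -/
def Overlapping {α : Type u} [Lattice α]
    (κ : {j : α // JoinIrred j} → {m : α // MeetIrred m}) : Prop :=
  ∀ x y : α, x ⋖ y → ∃! j : {j : α // JoinIrred j}, j.1 ≤ y ∧ x ≤ (κ j).1

/-- Compatibly dismantlable lattices: either a one-element lattice, or a uniquely paired
lattice with a prime pair `(j0, m0)` whose intervals `[j0, ⊤] = Set.Ici j0` and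
`[⊥, m0] = Set.Iic m0` are compatibly dismantlable, together with the compatibility
conditions relating the unique pairings via `α j = j0 ⊔ j` and `β m = m0 ⊓ m`. -/
inductive CompatiblyDismantlable : (β : Type u) → [Lattice β] → [Finite β] → Prop
  | singleton (β : Type u) [Lattice β] [Finite β] (h : Nat.card β = 1) :
      CompatiblyDismantlable β
  | step (β : Type u) [Lattice β] [Finite β]
      (κ : {j : β // JoinIrred j} → {m : β // MeetIrred m})
      (hκ : IsPairing κ) (huniq : ∀ κ', IsPairing κ' → κ' = κ)
      (j0 m0 : β) (hpp : IsPrimePair j0 m0)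
      (hup : CompatiblyDismantlable ↥(Set.Ici j0))
      (hdn : CompatiblyDismantlable ↥(Set.Iic m0))
      (κup : {j : ↥(Set.Ici j0) // JoinIrred j} → {m : ↥(Set.Ici j0) // MeetIrred m})
      (hκup : IsPairing κup) (hκupuniq : ∀ κ', IsPairing κ' → κ' = κup)
      (κdn : {j : ↥(Set.Iic m0) // JoinIrred j} → {m : ↥(Set.Iic m0) // MeetIrred m})
      (hκdn : IsPairing κdn) (hκdnuniq : ∀ κ', IsPairing κ' → κ' = κdn)
      (halpha : ∀ j : {j : β // JoinIrred j}, j0 ≤ (κ j).1 →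
          ∃ hji : JoinIrred (⟨j0 ⊔ j.1, Set.mem_Ici.mpr le_sup_left⟩ : ↥(Set.Ici j0)),
            (κup ⟨⟨j0 ⊔ j.1, Set.mem_Ici.mpr le_sup_left⟩, hji⟩).1.1 = (κ j).1)
      (halphainj : ∀ j j' : {j : β // JoinIrred j}, j0 ≤ (κ j).1 → j0 ≤ (κ j').1 →
          j0 ⊔ j.1 = j0 ⊔ j'.1 → j = j')
      (halphasurj : ∀ j' : {j : ↥(Set.Ici j0) // JoinIrred j},
          ∃ j : {j : β // JoinIrred j}, j0 ≤ (κ j).1 ∧ j0 ⊔ j.1 = j'.1.1)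
      (hbeta : ∀ (j : {j : β // JoinIrred j}) (h : j.1 ≤ m0),
          ∃ hji : JoinIrred (⟨j.1, Set.mem_Iic.mpr h⟩ : ↥(Set.Iic m0)),
            (κdn ⟨⟨j.1, Set.mem_Iic.mpr h⟩, hji⟩).1.1 = m0 ⊓ (κ j).1)
      (hbetainj : ∀ j j' : {j : β // JoinIrred j}, j.1 ≤ m0 → j'.1 ≤ m0 →
          m0 ⊓ (κ j).1 = m0 ⊓ (κ j').1 → j = j')
      (hbetasurj : ∀ m' : {m : ↥(Set.Iic m0) // MeetIrred m},
          ∃ j : {j : β // JoinIrred j}, j.1 ≤ m0 ∧ m0 ⊓ (κ j).1 = m'.1.1) :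
      CompatiblyDismantlable β

/-- A lattice is semidistrim if it is compatibly dismantlable and the downward and upward
label sets of every element are independent sets of the Galois graph. -/
def Semidistrim (β : Type u) [Lattice β] [Finite β] : Prop :=
  CompatiblyDismantlable β ∧
    ∀ κ : {j : β // JoinIrred j} → {m : β // MeetIrred m}, IsPairing κ →
      ∀ x : β, IndepSet κ (DLabel κ x) ∧ IndepSet κ (ULabel κ x)


lemma not_le_kappa {α : Type u} [Lattice α]
    {κ : {j : α // JoinIrred j} → {m : α // MeetIrred m}}
    (hκ : IsPairing κ) (j : {j : α // JoinIrred j}) : ¬ j.1 ≤ (κ j).1 := by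
  intro h
  obtain ⟨z, hz, -⟩ := j.2
  have h1 := (hκ.2.1 j z hz).1
  simp only [inf_eq_left.mpr h] at h1
  exact hz.lt.ne h1.symm

lemma le_kappa_of_covBy {α : Type u} [Lattice α]
    {κ : {j : α // JoinIrred j} → {m : α // MeetIrred m}}
    (hκ : IsPairing κ) (j : {j : α // JoinIrred j}) (z : α) (hz : z ⋖ j.1) : z ≤ (κ j).1 := by
  have h1 : j.1 ⊓ (κ j).1 = z := (hκ.2.1 j z hz).1
  exact h1 ▸ inf_le_right

lemma exists_lower {α : Type u} [Lattice α] [Finite α] {a b : α} (h : a < b) :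
    ∃ z, a ≤ z ∧ z ⋖ b := by
  have hf : (Set.Ico a b).Finite := Set.toFinite _
  obtain ⟨z, hz⟩ := hf.exists_maximal ⟨a, le_rfl, h⟩
  refine ⟨z, hz.1.1, hz.1.2, fun c hc hcb => ?_⟩
  exact absurd (hz.2 ⟨hz.1.1.trans hc.le, hcb⟩ hc.le) hc.not_ge

lemma exists_upper {α : Type u} [Lattice α] [Finite α] {a b : α} (h : a < b) :
    ∃ z, a ⋖ z ∧ z ≤ b := by
  have hf : (Set.Ioc a b).Finite := Set.toFinite _
  obtain ⟨z, hz⟩ := hf.exists_minimal ⟨b, h, le_rfl⟩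
  refine ⟨z, ⟨hz.1.1, fun c hc hcb => ?_⟩, hz.1.2⟩
  exact absurd (hz.2 ⟨hc, hcb.le.trans hz.1.2⟩ hcb.le) hcb.not_ge

lemma prime_joinIrred {α : Type u} [Lattice α] {j0 m0 : α} (h : IsPrimePair j0 m0) :
    (j0 ⊓ m0 ⋖ j0) ∧ JoinIrred j0 := by
  have hlt : ∀ z, z < j0 → z ≤ j0 ⊓ m0 := by
    intro z hz
    refine le_inf hz.le ?_
    rcases (h z).1 with h1 | h1
    · exact h1
    · exact absurd h1 hz.not_ge
  have hc : j0 ⊓ m0 ⋖ j0 := by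
    refine ⟨lt_of_le_of_ne inf_le_left fun he => ?_, fun c hc hcj => ?_⟩
    · exact (h j0).2 ⟨inf_eq_left.mp he, le_rfl⟩
    · exact absurd (hlt c hcj) hc.not_ge
  refine ⟨hc, j0 ⊓ m0, hc, fun y hy => ?_⟩
  have h1 := hlt y hy.lt
  by_contra hne
  exact hy.2 (lt_of_le_of_ne h1 hne) hc.lt

lemma prime_kappa {α : Type u} [Lattice α]
    {κ : {j : α // JoinIrred j} → {m : α // MeetIrred m}}
    (hκ : IsPairing κ) {j0 m0 : α} (h : IsPrimePair j0 m0) :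
    (κ ⟨j0, (prime_joinIrred h).2⟩).1 = m0 := by
  have hm := hκ.2.1 ⟨j0, (prime_joinIrred h).2⟩ _ (prime_joinIrred h).1
  have hle : (κ ⟨j0, (prime_joinIrred h).2⟩).1 ≤ m0 := by
    rcases (h (κ ⟨j0, (prime_joinIrred h).2⟩).1).1 with h1 | h1
    · exact h1
    · exact absurd h1 (not_le_kappa hκ ⟨j0, (prime_joinIrred h).2⟩)
  exact le_antisymm hle (hm.2 rfl hle)

lemma main_ind (α : Type u) [Lattice α] [Finite α] (h : CompatiblyDismantlable α) :
    ∀ κ : {j : α // JoinIrred j} → {m : α // MeetIrred m}, IsPairing κ →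
      (∀ x y : α, x ⋖ y → ∃ j : {j : α // JoinIrred j}, j.1 ≤ y ∧ x ≤ (κ j).1) ∧
      {S | IndepSet κ S}.ncard ≤ Nat.card α := by
  induction h with
  | singleton β h =>
    intro κ _
    have hs : Subsingleton β := (Nat.card_eq_one_iff_unique.mp h).1
    refine ⟨fun x y hxy => absurd (Subsingleton.elim x y) hxy.lt.ne, ?_⟩
    have he : IsEmpty {j : β // JoinIrred j} :=
      ⟨fun j => by
        obtain ⟨z, hz, -⟩ := j.2
        exact hz.lt.ne (Subsingleton.elim _ _)⟩
    rw [h]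
    exact Set.ncard_le_one_of_subsingleton _
  | step β κ hκ huniq j0 m0 hpp hup hdn κup hκup _ κdn hκdn _ halpha halphainj halphasurj
      hbeta hbetainj hbetasurj ihup ihdn =>
    intro κ' hκ'
    obtain rfl := huniq κ' hκ'
    obtain ⟨lup, cup⟩ := ihup κup hκup
    obtain ⟨ldn, cdn⟩ := ihdn κdn hκdn
    have hk0 := prime_kappa hκ hpp
    set J0 : {j : β // JoinIrred j} := ⟨j0, (prime_joinIrred hpp).2⟩ with hJ0
    refine ⟨?_, ?_⟩
    · intro x y hxy
      rcases (hpp x).1 with hx | hx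
      · rcases (hpp y).1 with hy | hy
        · obtain ⟨j', h1, h2⟩ := ldn ⟨x, hx⟩ ⟨y, hy⟩
            ⟨hxy.1, fun c hc hcy => hxy.2 (c := c.1) hc hcy⟩
          obtain ⟨j, hj, hj'⟩ := hbetasurj (κdn j')
          obtain ⟨hji, he⟩ := hbeta j hj
          have hjj : (⟨⟨j.1, hj⟩, hji⟩ : {j : ↥(Set.Iic m0) // JoinIrred j}) = j' := by
            apply hκdn.1.1
            apply Subtype.ext
            apply Subtype.ext
            rw [he, hj']
          subst hjj
          refine ⟨j, h1, ?_⟩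
          have h3 : x ≤ (κdn ⟨⟨j.1, hj⟩, hji⟩).1.1 := h2
          rw [he] at h3
          exact h3.trans inf_le_right
        · exact ⟨J0, hy, hk0 ▸ hx⟩
      · have hy : j0 ≤ y := hx.trans hxy.le
        obtain ⟨j', h1, h2⟩ := lup ⟨x, hx⟩ ⟨y, hy⟩
            ⟨hxy.1, fun c hc hcy => hxy.2 (c := c.1) hc hcy⟩
        obtain ⟨j, hj, hj'⟩ := halphasurj j'
        obtain ⟨hji, he⟩ := halpha j hj
        have hjj : (⟨⟨j0 ⊔ j.1, Set.mem_Ici.mpr le_sup_left⟩, hji⟩ :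
            {j : ↥(Set.Ici j0) // JoinIrred j}) = j' := Subtype.ext (Subtype.ext hj')
        subst hjj
        have h4 : j0 ⊔ j.1 ≤ y := h1
        refine ⟨j, le_sup_right.trans h4, ?_⟩
        rw [← he]
        exact h2
    · set A : Set (Set {j : β // JoinIrred j}) :=
        {S | IndepSet κ' S ∧ ∀ j ∈ S, j.1 ≤ m0} with hA
      set B : Set (Set {j : β // JoinIrred j}) :=
        {S | IndepSet κ' S ∧ ∀ j ∈ S, j0 ≤ (κ' j).1} with hB
      set C : Set (Set {j : β // JoinIrred j}) :=
        {S | IndepSet κ' S ∧ J0 ∈ S} with hC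
      have hcov : {S | IndepSet κ' S} ⊆ (A ∪ B) ∪ C := by
        intro S hS
        by_cases h0 : J0 ∈ S
        · exact Or.inr ⟨hS, h0⟩
        left
        by_contra hn
        have hnA : ¬ ∀ j ∈ S, j.1 ≤ m0 := fun h => hn (Or.inl ⟨hS, h⟩)
        have hnB : ¬ ∀ j ∈ S, j0 ≤ (κ' j).1 := fun h => hn (Or.inr ⟨hS, h⟩)
        push Not at hnA hnB
        obtain ⟨j, hj, hjm⟩ := hnA
        obtain ⟨i, hi, him⟩ := hnB
        have hj0 : j0 ≤ j.1 := (hpp j.1).1.resolve_left hjm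
        have hi0 : (κ' i).1 ≤ m0 := (hpp (κ' i).1).1.resolve_right him
        by_cases hij : j = i
        · subst hij
          have hlt : j0 < j.1 := lt_of_le_of_ne hj0 fun he => h0 (by
            have : J0 = j := Subtype.ext he
            rwa [this])
          obtain ⟨z, hz, hzj⟩ := exists_lower hlt
          exact him (hz.trans (le_kappa_of_covBy hκ j z hzj))
        · exact hS j hj i hi ⟨hij, fun hle => hjm (hle.trans hi0)⟩
      have hCAB : C.ncard ≤ (A ∩ B).ncard := by
        refine Set.ncard_le_ncard_of_injOn (fun S => S \ {J0}) ?_ ?_ (Set.toFinite _)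
        · rintro S ⟨hS, h0⟩
          have hS' : IndepSet κ' (S \ {J0}) := fun j hj j' hj' => hS j hj.1 j' hj'.1
          refine ⟨⟨hS', fun j hj => ?_⟩, ⟨hS', fun j hj => ?_⟩⟩
          · by_contra hn
            exact hS j hj.1 J0 h0 ⟨hj.2, hk0.symm ▸ hn⟩
          · by_contra hn
            exact hS J0 h0 j hj.1 ⟨fun h => hj.2 h.symm, hn⟩
        · rintro S ⟨hS, h0⟩ T ⟨hT, h0'⟩ hST
          have h1 := congrArg (insert J0) hST
          simpa [Set.insert_eq_of_mem h0, Set.insert_eq_of_mem h0'] using h1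
      have hAc : A.ncard ≤ {S | IndepSet κdn S}.ncard := by
        refine Set.ncard_le_ncard_of_injOn (fun S => {j' | ∃ j ∈ S, j.1 = j'.1.1}) ?_ ?_
          (Set.toFinite _)
        · rintro S ⟨hS, hm⟩ a ⟨j, hj, hja⟩ b ⟨i, hi, hib⟩ ⟨hne, hnle⟩
          obtain ⟨hji, he⟩ := hbeta i (hm i hi)
          have hb : (⟨⟨i.1, hm i hi⟩, hji⟩ : {j : ↥(Set.Iic m0) // JoinIrred j}) = b :=
            Subtype.ext (Subtype.ext hib)
          subst hb
          have hij : j ≠ i := by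
            rintro rfl
            exact hne (Subtype.ext (Subtype.ext hja.symm))
          have hle : j.1 ≤ (κ' i).1 := by
            by_contra hn
            exact hS j hj i hi ⟨hij, hn⟩
          apply hnle
          change a.1.1 ≤ (κdn ⟨⟨i.1, hm i hi⟩, hji⟩).1.1
          rw [he, ← hja]
          exact le_inf (hm j hj) hle
        · have key : ∀ S ∈ A, ∀ T ∈ A,
              {j' : {j : ↥(Set.Iic m0) // JoinIrred j} | ∃ j ∈ S, j.1 = j'.1.1} =
              {j' | ∃ j ∈ T, j.1 = j'.1.1} → S ⊆ T := by
            rintro S ⟨hS, hm⟩ T ⟨hT, hm'⟩ hST j hj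
            obtain ⟨hji, he⟩ := hbeta j (hm j hj)
            have : (⟨⟨j.1, hm j hj⟩, hji⟩ : {j : ↥(Set.Iic m0) // JoinIrred j}) ∈
              {j' : {j : ↥(Set.Iic m0) // JoinIrred j} | ∃ j ∈ S, j.1 = j'.1.1} := ⟨j, hj, rfl⟩
            rw [hST] at this
            obtain ⟨i, hi, hij⟩ := this
            rwa [← show i = j from Subtype.ext hij]
          intro S hS T hT hST
          exact (key S hS T hT hST).antisymm (key T hT S hS hST.symm)
      have hBc : B.ncard ≤ {S | IndepSet κup S}.ncard := by
        refine Set.ncard_le_ncard_of_injOn (fun S => {j' | ∃ j ∈ S, j0 ⊔ j.1 = j'.1.1}) ?_ ?_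
          (Set.toFinite _)
        · rintro S ⟨hS, hm⟩ a ⟨j, hj, hja⟩ b ⟨i, hi, hib⟩ ⟨hne, hnle⟩
          obtain ⟨hji, he⟩ := halpha i (hm i hi)
          have hb : (⟨⟨j0 ⊔ i.1, Set.mem_Ici.mpr le_sup_left⟩, hji⟩ :
              {j : ↥(Set.Ici j0) // JoinIrred j}) = b :=
            Subtype.ext (Subtype.ext hib)
          subst hb
          have hij : j ≠ i := by
            rintro rfl
            exact hne (Subtype.ext (Subtype.ext hja.symm))
          have hle : j.1 ≤ (κ' i).1 := by
            by_contra hn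
            exact hS j hj i hi ⟨hij, hn⟩
          apply hnle
          change a.1.1 ≤ (κup ⟨⟨j0 ⊔ i.1, Set.mem_Ici.mpr le_sup_left⟩, hji⟩).1.1
          rw [he, ← hja]
          exact sup_le (hm i hi) hle
        · have key : ∀ S ∈ B, ∀ T ∈ B,
              {j' : {j : ↥(Set.Ici j0) // JoinIrred j} | ∃ j ∈ S, j0 ⊔ j.1 = j'.1.1} =
              {j' | ∃ j ∈ T, j0 ⊔ j.1 = j'.1.1} → S ⊆ T := by
            rintro S ⟨hS, hm⟩ T ⟨hT, hm'⟩ hST j hj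
            obtain ⟨hji, he⟩ := halpha j (hm j hj)
            have : (⟨⟨j0 ⊔ j.1, Set.mem_Ici.mpr le_sup_left⟩, hji⟩ :
                {j : ↥(Set.Ici j0) // JoinIrred j}) ∈
              {j' : {j : ↥(Set.Ici j0) // JoinIrred j} | ∃ j ∈ S, j0 ⊔ j.1 = j'.1.1} :=
                ⟨j, hj, rfl⟩
            rw [hST] at this
            obtain ⟨i, hi, hij⟩ := this
            rwa [← halphainj i j (hm' i hi) (hm j hj) hij]
          intro S hS T hT hST
          exact (key S hS T hT hST).antisymm (key T hT S hS hST.symm)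
      have hcard : (Set.Ici j0).ncard + (Set.Iic m0).ncard = Nat.card β := by
        rw [← Set.ncard_univ, ← Set.ncard_union_eq _ (Set.toFinite _) (Set.toFinite _)]
        · congr 1
          ext z
          simpa using (hpp z).1.symm
        · rw [Set.disjoint_left]
          exact fun z h1 h2 => (hpp z).2 ⟨h2, h1⟩
      have e1 := Set.ncard_le_ncard hcov (Set.toFinite _)
      have e2 := Set.ncard_union_le (A ∪ B) C
      have e3 := Set.ncard_union_add_ncard_inter A B (Set.toFinite _) (Set.toFinite _)
      rw [Nat.card_coe_set_eq] at cup cdn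
      omega

lemma bijOn_of_card {α β : Type u} [Finite α] [Finite β] (f : α → Set β) (T : Set (Set β))
    (hm : ∀ x, f x ∈ T) (hi : Function.Injective f) (hc : T.ncard ≤ Nat.card α) :
    Set.BijOn (fun x : α => f x) Set.univ T := by
  refine ⟨fun x _ => hm x, hi.injOn, ?_⟩
  have h1 : f '' Set.univ ⊆ T := by
    rintro _ ⟨x, -, rfl⟩
    exact hm x
  have h2 : f '' Set.univ = T := by
    refine Set.eq_of_subset_of_ncard_le h1 ?_ (Set.toFinite _)
    rw [Set.ncard_image_of_injective _ hi, Set.ncard_univ]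
    exact hc
  exact h2.ge

/-- in a semidistrim lattice, `x ↦ D_L(x)` and `x ↦ U_L(x)` are bijections
from `L` onto the independent sets of the Galois graph. -/
theorem stmt12 {α : Type u} [Lattice α] [Finite α]
    (hsd : Semidistrim α)
    (κ : {j : α // JoinIrred j} → {m : α // MeetIrred m})
    (hκ : IsPairing κ) (huniq : ∀ κ', IsPairing κ' → κ' = κ) :
    Set.BijOn (fun x : α => DLabel κ x) Set.univ {S | IndepSet κ S} ∧
    Set.BijOn (fun x : α => ULabel κ x) Set.univ {S | IndepSet κ S} := by
  obtain ⟨hl, hc⟩ := main_ind α hsd.1 κ hκ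
  have hD : ∀ x x' : α, DLabel κ x = DLabel κ x' → x ≤ x' := by
    intro x x' h
    by_contra hn
    obtain ⟨y, hy, hyx⟩ := exists_lower (lt_of_le_of_ne (inf_le_left : x ⊓ x' ≤ x)
      fun he => hn (inf_eq_left.mp he))
    obtain ⟨j, h1, h2⟩ := hl y x hyx
    have hj : j ∈ DLabel κ x := ⟨y, hyx, h1, h2⟩
    rw [h] at hj
    obtain ⟨_, _, h3, _⟩ := hj
    exact not_le_kappa hκ j (((le_inf h1 h3).trans hy).trans h2)
  have hU : ∀ x x' : α, ULabel κ x = ULabel κ x' → x' ≤ x := by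
    intro x x' h
    by_contra hn
    obtain ⟨y, hxy, hy⟩ := exists_upper (lt_of_le_of_ne (le_sup_left : x ≤ x ⊔ x')
      fun he => hn (sup_eq_left.mp he.symm))
    obtain ⟨j, h1, h2⟩ := hl x y hxy
    have hj : j ∈ ULabel κ x := ⟨y, hxy, h1, h2⟩
    rw [h] at hj
    obtain ⟨_, _, _, h3⟩ := hj
    exact not_le_kappa hκ j ((h1.trans hy).trans (sup_le h2 h3))
  exact ⟨bijOn_of_card _ _ (fun x => (hsd.2 κ hκ x).1)
      (fun x x' h => (hD x x' h).antisymm (hD x' x h.symm)) hc,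
    bijOn_of_card _ _ (fun x => (hsd.2 κ hκ x).2)
      (fun x x' h => (hU x' x h.symm).antisymm (hU x x' h)) hc⟩
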